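/- arXiv:1412.7000 — 6 statements merged into one kernel-verified Lean document; each statement's English description precedes it below -/
import Mathlib

section
/- Lemma 3.9: Let Q = (x₁,x₂) × (y₁,y₂) ⊂ ℝ² (with x₁ < x₂ and y₁ < y₂) be an open rectangle with sides parallel to the coordinate axes, and let L be the union of at most N₁ lines in ℝ², i.e. L = ⋃_{i} ℓ_i where the ℓ_i = {p ∈ ℝ² : a_i p₁ + b_i p₂ = c_i} with (a_i,b_i) ≠ (0,0) are indexed by a set of cardinality at most N₁. Then the set of connected components of Q \ L is finite and has cardinality at most 2·(N₁+4)·(N₁+5). -/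
open Set

section HyperplaneArrangement

variable {E ι : Type*} [AddCommGroup E] [Module ℝ E]

open Classical in
/-- The set of indices in `s` whose hyperplane `{f i = c i}` has `p` on its positive side. -/
noncomputable def positiveSides (f : ι → E →ₗ[ℝ] ℝ) (c : ι → ℝ) (s : Finset ι) (p : E) :
    Finset ι :=
  s.filter fun i => c i < f i p

/-- The sign patterns, with respect to the hyperplanes `{f i = c i}` with `i ∈ s`, of the points of
`K` that lie on none of these hyperplanes. -/
def signPatterns (f : ι → E →ₗ[ℝ] ℝ) (c : ι → ℝ) (K : Set E) (s : Finset ι) : Set (Finset ι) :=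
  positiveSides f c s '' {p ∈ K | ∀ i ∈ s, f i p ≠ c i}

variable {f : ι → E →ₗ[ℝ] ℝ} {c : ι → ℝ} {K : Set E} {s : Finset ι}

lemma mem_positiveSides {p : E} {i : ι} : i ∈ positiveSides f c s p ↔ i ∈ s ∧ c i < f i p := by
  simp [positiveSides]

lemma signPatterns_finite : (signPatterns f c K s).Finite := by
  refine (s.powerset.finite_toSet).subset ?_
  rintro _ ⟨p, -, rfl⟩
  simp only [Finset.coe_powerset, mem_preimage, mem_powerset_iff, Finset.coe_subset]
  exact fun i hi => (mem_positiveSides.1 hi).1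

lemma lt_iff_lt_of_positiveSides_eq {p q : E} (h : positiveSides f c s p = positiveSides f c s q)
    {i : ι} (hi : i ∈ s) : c i < f i p ↔ c i < f i q := by
  have := Finset.ext_iff.1 h i
  simpa [mem_positiveSides, hi] using this

/-- A segment joining two points with the same sign pattern stays in the same cell. -/
lemma lt_iff_lt_and_ne_of_mem_segment {p q z : E} {i : ι} (hp : f i p ≠ c i) (hq : f i q ≠ c i)
    (h : c i < f i p ↔ c i < f i q) (hz : z ∈ segment ℝ p q) :
    (c i < f i z ↔ c i < f i p) ∧ f i z ≠ c i := by
  by_cases hpos : c i < f i p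
  · have : z ∈ {w | c i < f i w} :=
      (convex_halfSpace_gt (f i).isLinear (c i)).segment_subset hpos (h.1 hpos) hz
    exact ⟨iff_of_true this hpos, ne_of_gt this⟩
  · have hneg : f i p < c i := lt_of_le_of_ne (not_lt.1 hpos) hp
    have hneg' : f i q < c i := lt_of_le_of_ne (not_lt.1 fun h' => hpos (h.2 h')) hq
    have : z ∈ {w | f i w < c i} :=
      (convex_halfSpace_lt (f i).isLinear (c i)).segment_subset hneg hneg' hz
    exact ⟨iff_of_false (not_lt_of_gt this) hpos, ne_of_lt this⟩

lemma exists_mem_segment_eq {g : E →ₗ[ℝ] ℝ} {d : ℝ} {p q : E} (hp : d < g p) (hq : g q < d) :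
    ∃ z ∈ segment ℝ p q, g z = d := by
  have h : d ∈ g '' segment ℝ p q := by
    rw [show g '' segment ℝ p q = segment ℝ (g p) (g q) from image_segment ℝ g.toAffineMap p q,
      segment_symm, segment_eq_Icc (hq.trans hp).le]
    exact ⟨hq.le, hp.le⟩
  exact h

/-- Deletion–restriction: adding a hyperplane creates at most as many sign patterns as are
realized on that hyperplane. -/
lemma ncard_signPatterns_insert_le [DecidableEq ι] (hK : Convex ℝ K) {j : ι} (hj : j ∉ s) :
    (signPatterns f c K (insert j s)).ncard ≤
      (signPatterns f c K s).ncard + (signPatterns f c (K ∩ {p | f j p = c j}) s).ncard := by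
  set T := signPatterns f c K (insert j s)
  have hTfin : T.Finite := signPatterns_finite
  set T₁ := {A ∈ T | j ∈ A}
  set T₀ := {A ∈ T | j ∉ A}
  have herase (p : E) : (positiveSides f c (insert j s) p).erase j = positiveSides f c s p := by
    ext i
    simp only [Finset.mem_erase, mem_positiveSides, Finset.mem_insert]
    grind
  have hE (A) (hA : A ∈ T) : ∃ p ∈ K, (∀ i ∈ s, f i p ≠ c i) ∧ f j p ≠ c j ∧
      (j ∈ A ↔ c j < f j p) ∧ A.erase j = positiveSides f c s p := by
    obtain ⟨p, ⟨hpK, hp⟩, rfl⟩ := hA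
    exact ⟨p, hpK, fun i hi => hp i (Finset.mem_insert_of_mem hi),
      hp j (Finset.mem_insert_self j s), by simp [mem_positiveSides], herase p⟩
  have hT₁ : T₁.ncard = ((fun A => A.erase j) '' T₁).ncard := by
    refine (InjOn.ncard_image fun A hA B hB h => ?_).symm
    rw [← Finset.insert_erase hA.2, ← Finset.insert_erase hB.2]
    exact congrArg _ h
  have hT₀ : T₀.ncard = ((fun A => A.erase j) '' T₀).ncard := by
    refine (InjOn.ncard_image fun A hA B hB h => ?_).symm
    rw [← Finset.erase_eq_of_notMem hA.2, ← Finset.erase_eq_of_notMem hB.2]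
    exact h
  have hsplit : T ⊆ T₁ ∪ T₀ := fun A hA => by
    by_cases h : j ∈ A
    · exact Or.inl ⟨hA, h⟩
    · exact Or.inr ⟨hA, h⟩
  have hfin₁ : T₁.Finite := hTfin.subset fun A hA => hA.1
  have hfin₀ : T₀.Finite := hTfin.subset fun A hA => hA.1
  calc T.ncard ≤ (T₁ ∪ T₀).ncard := ncard_le_ncard hsplit (hfin₁.union hfin₀)
    _ ≤ T₁.ncard + T₀.ncard := ncard_union_le _ _
    _ = ((fun A => A.erase j) '' T₁ ∪ (fun A => A.erase j) '' T₀).ncard +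
        ((fun A => A.erase j) '' T₁ ∩ (fun A => A.erase j) '' T₀).ncard := by
      rw [hT₁, hT₀, ncard_union_add_ncard_inter _ _ (hfin₁.image _) (hfin₀.image _)]
    _ ≤ _ := by
      refine add_le_add (ncard_le_ncard ?_ signPatterns_finite)
        (ncard_le_ncard ?_ signPatterns_finite)
      · rintro _ (⟨A, hA, rfl⟩ | ⟨A, hA, rfl⟩) <;>
        · obtain ⟨p, hpK, hp, -, -, h⟩ := hE A hA.1
          exact ⟨p, ⟨hpK, hp⟩, h.symm⟩
      · rintro _ ⟨⟨A, hA, rfl⟩, ⟨B, hB, hBA⟩⟩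
        obtain ⟨p, hpK, hp, -, hpA, hAp⟩ := hE A hA.1
        obtain ⟨q, hqK, hq, hqj, hqB, hBq⟩ := hE B hB.1
        have hsame : positiveSides f c s p = positiveSides f c s q := by
          rw [← hAp, ← hBq]; exact hBA.symm
        obtain ⟨z, hz, hzj⟩ := exists_mem_segment_eq (hpA.1 hA.2)
          (lt_of_le_of_ne (not_lt.1 fun h => hB.2 (hqB.2 h)) hqj)
        have key (i) (hi : i ∈ s) := lt_iff_lt_and_ne_of_mem_segment (hp i hi) (hq i hi)
          (lt_iff_lt_of_positiveSides_eq hsame hi) hz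
        refine ⟨z, ⟨⟨hK.segment_subset hpK hqK hz, hzj⟩, fun i hi => (key i hi).2⟩, ?_⟩
        change _ = A.erase j
        rw [hAp]
        ext i
        simp only [mem_positiveSides]
        exact and_congr_right fun hi => (key i hi).1

lemma ncard_signPatterns_le_one (hK : K.Subsingleton) : (signPatterns f c K s).ncard ≤ 1 :=
  have := (signPatterns_finite (f := f) (c := c) (K := K) (s := s)).to_subtype
  ncard_le_one_iff_subsingleton.2 ((hK.anti fun _ h => h.1).image _)

/-- If each hyperplane contains `K` or meets it in at most one point, then there are at most
`#s + 1` sign patterns. -/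
lemma ncard_signPatterns_le_card_add_one (hK : Convex ℝ K)
    (h : ∀ i ∈ s, K ⊆ {p | f i p = c i} ∨ (K ∩ {p | f i p = c i}).Subsingleton) :
    (signPatterns f c K s).ncard ≤ s.card + 1 := by
  classical
  induction s using Finset.induction_on with
  | empty =>
    refine (ncard_le_one signPatterns_finite).2 ?_ |>.trans (by simp)
    rintro _ ⟨p, -, rfl⟩ _ ⟨q, -, rfl⟩
    simp [positiveSides]
  | insert j s hj ih =>
    rcases h j (Finset.mem_insert_self j s) with hsub | hsub
    · have : signPatterns f c K (insert j s) = ∅ := by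
        refine eq_empty_of_forall_notMem ?_
        rintro _ ⟨p, ⟨hpK, hp⟩, -⟩
        exact hp j (Finset.mem_insert_self j s) (hsub hpK)
      simp [this]
    · rw [Finset.card_insert_of_notMem hj]
      exact (ncard_signPatterns_insert_le hK hj).trans <| add_le_add
        (ih fun i hi => h i (Finset.mem_insert_of_mem hi)) (ncard_signPatterns_le_one hsub)

/-- If any two of the hyperplanes are nested or meet in at most one point, then there are at most
`#s ^ 2 + 1` sign patterns. -/
lemma ncard_signPatterns_le_card_sq_add_one (hK : Convex ℝ K)
    (h : ∀ i ∈ s, ∀ j ∈ s, {p | f j p = c j} ⊆ {p | f i p = c i} ∨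
      ({p | f j p = c j} ∩ {p | f i p = c i}).Subsingleton) :
    (signPatterns f c K s).ncard ≤ s.card ^ 2 + 1 := by
  classical
  induction s using Finset.induction_on with
  | empty => simpa using ncard_signPatterns_le_card_add_one (f := f) (c := c) (s := ∅) hK (by simp)
  | insert j s hj ih =>
    have hle := (ncard_signPatterns_insert_le hK hj (f := f) (c := c)).trans <| add_le_add
      (ih fun i hi k hk => h i (Finset.mem_insert_of_mem hi) k (Finset.mem_insert_of_mem hk))
      (ncard_signPatterns_le_card_add_one
        (hK.inter (convex_hyperplane (f j).isLinear (c j))) fun i hi =>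
          (h i (Finset.mem_insert_of_mem hi) j (Finset.mem_insert_self j s)).imp
            (fun hs => inter_subset_right.trans hs)
            (fun hs => hs.anti (inter_subset_inter_left _ inter_subset_right)))
    rw [Finset.card_insert_of_notMem hj]
    nlinarith

end HyperplaneArrangement

/-- Two lines in the plane are equal, or meet in at most one point. -/
lemma line_subset_or_inter_subsingleton {a b c a' b' c' : ℝ} (h : (a, b) ≠ (0, 0)) :
    {p : ℝ × ℝ | a * p.1 + b * p.2 = c} ⊆ {p : ℝ × ℝ | a' * p.1 + b' * p.2 = c'} ∨
      ({p : ℝ × ℝ | a * p.1 + b * p.2 = c} ∩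
        {p : ℝ × ℝ | a' * p.1 + b' * p.2 = c'}).Subsingleton := by
  by_cases hdet : a * b' - a' * b = 0
  · by_cases hne : ∃ q ∈ {p : ℝ × ℝ | a * p.1 + b * p.2 = c},
      q ∈ {p : ℝ × ℝ | a' * p.1 + b' * p.2 = c'}
    · obtain ⟨q, hq, hq'⟩ := hne
      left
      intro p hp
      simp only [mem_ofPred_eq] at hp hq hq' ⊢
      rcases eq_or_ne a 0 with ha | ha
      · have hb : b ≠ 0 := fun hb => h (by rw [ha, hb])
        refine mul_left_cancel₀ hb ?_
        linear_combination b' * hp - b' * hq + b * hq' + (q.1 - p.1) * hdet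
      · refine mul_left_cancel₀ ha ?_
        linear_combination a' * hp - a' * hq + a * hq' + (p.2 - q.2) * hdet
    · right
      exact fun p hp => (hne ⟨p, hp.1, hp.2⟩).elim
  · right
    rintro p ⟨hp, hp'⟩ q ⟨hq, hq'⟩
    simp only [mem_ofPred_eq] at hp hp' hq hq'
    refine Prod.ext (mul_left_cancel₀ hdet ?_) (mul_left_cancel₀ hdet ?_)
    · linear_combination b' * hp - b' * hq - b * hp' + b * hq'
    · linear_combination a * hp' - a * hq' - a' * hp + a' * hq

/-- Points joined by a segment inside `X` lie in the same connected component of `X`. -/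
lemma connectedComponents_mk_eq_of_segment_subset {E : Type*} [AddCommGroup E] [Module ℝ E]
    [TopologicalSpace E] [ContinuousAdd E] [ContinuousSMul ℝ E] {X : Set E} {p q : X}
    (h : segment ℝ (p : E) q ⊆ X) :
    (p : ConnectedComponents X) = q := by
  have hpre : IsPreconnected ((↑) ⁻¹' segment ℝ (p : E) q : Set X) := by
    rw [← Topology.IsInducing.subtypeVal.isPreconnected_image, Subtype.image_preimage_coe,
      inter_eq_right.2 h]
    exact (convex_segment _ _).isPreconnected
  exact ConnectedComponents.coe_eq_coe'.2
    (hpre.subset_connectedComponent (right_mem_segment ℝ _ _) (left_mem_segment ℝ _ _))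

/-- **Lemma 3.9.** Let `Q = (x₁,x₂) × (y₁,y₂)` be an open rectangle in `ℝ²` with sides parallel
to the axes, and let `L` be the union of at most `N₁` lines in `ℝ²`. Then the set of connected
components of `Q \ L` is finite, of cardinality at most `2·(N₁+4)·(N₁+5)`. -/
theorem rectangle_minus_lines_components
    (N₁ : ℕ) (x₁ x₂ y₁ y₂ : ℝ) (hx : x₁ < x₂) (hy : y₁ < y₂)
    (m : ℕ) (hm : m ≤ N₁) (a b c : Fin m → ℝ)
    (hab : ∀ i, (a i, b i) ≠ ((0 : ℝ), (0 : ℝ)))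
    (Q L : Set (ℝ × ℝ))
    (hQ : Q = Ioo x₁ x₂ ×ˢ Ioo y₁ y₂)
    (hL : L = ⋃ i, {p : ℝ × ℝ | a i * p.1 + b i * p.2 = c i}) :
    Finite (ConnectedComponents ↥(Q \ L)) ∧
      Nat.card (ConnectedComponents ↥(Q \ L)) ≤ 2 * (N₁ + 4) * (N₁ + 5) := by
  have hconv : Convex ℝ Q := hQ ▸ (convex_Ioo x₁ x₂).prod (convex_Ioo y₁ y₂)
  set f : Fin m → (ℝ × ℝ) →ₗ[ℝ] ℝ :=
    fun i => a i • LinearMap.fst ℝ ℝ ℝ + b i • LinearMap.snd ℝ ℝ ℝ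
  have hmem (p : ℝ × ℝ) : p ∉ L ↔ ∀ i, f i p ≠ c i := by simp [hL, f]
  have hcount : (signPatterns f c Q Finset.univ).ncard ≤ m ^ 2 + 1 := by
    simpa using ncard_signPatterns_le_card_sq_add_one (f := f) (c := c) (s := Finset.univ) hconv
      fun i _ j _ => line_subset_or_inter_subsingleton (hab j)
  have : Finite (signPatterns f c Q Finset.univ) := signPatterns_finite.to_subtype
  let g : ConnectedComponents ↥(Q \ L) → signPatterns f c Q Finset.univ := fun x =>
    ⟨positiveSides f c Finset.univ (Quotient.out x : ↥(Q \ L)), _,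
      ⟨(Quotient.out x).2.1, fun i _ => (hmem _).1 (Quotient.out x).2.2 i⟩, rfl⟩
  have hg : Function.Injective g := by
    intro x y hxy
    rw [← Quotient.out_eq x, ← Quotient.out_eq y]
    refine connectedComponents_mk_eq_of_segment_subset fun z hz => ?_
    refine ⟨hconv.segment_subset (Quotient.out x).2.1 (Quotient.out y).2.1 hz,
      (hmem z).2 fun i => ?_⟩
    exact (lt_iff_lt_and_ne_of_mem_segment ((hmem _).1 (Quotient.out x).2.2 i)
      ((hmem _).1 (Quotient.out y).2.2 i)
      (lt_iff_lt_of_positiveSides_eq (congrArg Subtype.val hxy) (Finset.mem_univ i)) hz).2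
  refine ⟨Finite.of_injective g hg, (Nat.card_le_card_of_injective g hg).trans ?_⟩
  rw [Nat.card_coe_set_eq]
  nlinarith
end

section
/- Lemma 3.12 (transported to the unit square by the diffeomorphism W used in its proof): Let a : [0,1] → [0,1] be a homeomorphism with a(0) = 0, a(1) = 1 and a(x) ≠ x for all x ∈ (0,1). Then there exists a homeomorphism T of the square [0,1] × [0,1] onto itself such that T(x,1) = (a(x),1) for all x ∈ [0,1], T(p) = p for every point p of the boundary part ({0,1} × [0,1]) ∪ ([0,1] × {0}), and the topological entropy of T is zero: h(T) = 0. -/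
open unitInterval

open Filter Topology in
/-- Sequences of polynomial growth have nonpositive exponential growth rate. -/
lemma expGrowthSup_nonpos_of_le_pow {u : ℕ → ENNReal} {d : ℕ}
    (hu : ∀ n, u n ≤ ((n + 1 : ℕ) : ENNReal) ^ d) : ExpGrowth.expGrowthSup u ≤ 0 := by
  refine EReal.le_of_forall_lt_iff_le.1 fun c hc ↦ ?_
  have hc : (0 : ℝ) < c := by exact_mod_cast hc
  refine Eventually.expGrowthSup_le ?_
  have ht : Tendsto (fun n : ℕ ↦ ((n : ℝ) + 1)) atTop atTop :=
    tendsto_atTop_add_const_right _ _ tendsto_natCast_atTop_atTop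
  have hlo := ((isLittleO_pow_exp_pos_mul_atTop d hc).comp_tendsto ht).bound
    (Real.exp_pos (-c))
  filter_upwards [hlo] with n hn
  refine (hu n).trans ?_
  have hn : ((n : ℝ) + 1) ^ d ≤ Real.exp (c * n) := by
    have h0 : (0 : ℝ) ≤ ((n : ℝ) + 1) ^ d := by positivity
    simp only [Function.comp_apply, Real.norm_eq_abs, Real.abs_exp, abs_of_nonneg h0,
      ← Real.exp_add] at hn
    convert hn using 2
    ring
  have he : ((c : EReal) * (n : EReal)) = ((c * n : ℝ) : EReal) := by
    push_cast
    rfl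
  rw [he, EReal.exp_coe]
  refine le_trans (le_of_eq ?_) (ENNReal.ofReal_le_ofReal hn)
  rw [ENNReal.ofReal_pow (by positivity), ← Nat.cast_succ, ENNReal.ofReal_natCast]

/-- For each level `j / M`, the number of times `k < n` at which the sequence `u` is below it. -/
noncomputable def crossingCode (n M : ℕ) (u : ℕ → ℝ) : Fin (M + 1) → Fin (n + 1) := fun j ↦
  ⟨((Finset.range n).filter fun k ↦ M * u k < j).card,
    Nat.lt_succ_of_le ((Finset.card_filter_le _ _).trans (Finset.card_range n).le)⟩

/-- Two monotone, or two antitone, sequences with equal crossing codes are below each level at the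
same times. -/
lemma lt_iff_lt_of_crossingCode_eq {n M : ℕ} {u v : ℕ → ℝ}
    (huv : Monotone u ∧ Monotone v ∨ Antitone u ∧ Antitone v)
    (h : crossingCode n M u = crossingCode n M v) {k : ℕ} (hk : k < n) {j : ℕ} (hj : j ≤ M) :
    M * u k < j ↔ M * v k < j := by
  have hcard : ((Finset.range n).filter fun k ↦ M * u k < j).card =
      ((Finset.range n).filter fun k ↦ M * v k < j).card :=
    congrArg Fin.val (congrFun h ⟨j, Nat.lt_succ_of_le hj⟩)
  have htotal : {k | M * u k < j} ⊆ {k | M * v k < j} ∨ {k | M * v k < j} ⊆ {k | M * u k < j} := by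
    rcases huv with ⟨hu, hv⟩ | ⟨hu, hv⟩
    · refine IsLowerSet.total (fun a b hab ha ↦ ?_) (fun a b hab ha ↦ ?_)
      · exact (mul_le_mul_of_nonneg_left (hu hab) M.cast_nonneg).trans_lt ha
      · exact (mul_le_mul_of_nonneg_left (hv hab) M.cast_nonneg).trans_lt ha
    · refine IsUpperSet.total (fun a b hab ha ↦ ?_) (fun a b hab ha ↦ ?_)
      · exact (mul_le_mul_of_nonneg_left (hu hab) M.cast_nonneg).trans_lt ha
      · exact (mul_le_mul_of_nonneg_left (hv hab) M.cast_nonneg).trans_lt ha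
  have heq : ((Finset.range n).filter fun k ↦ M * u k < j) =
      ((Finset.range n).filter fun k ↦ M * v k < j) := by
    rcases htotal with hs | hs
    · exact Finset.eq_of_subset_of_card_le
        (Finset.monotone_filter_right _ fun k _ hk ↦ hs hk) hcard.ge
    · exact (Finset.eq_of_subset_of_card_le
        (Finset.monotone_filter_right _ fun k _ hk ↦ hs hk) hcard.le).symm
  simpa [hk] using Finset.ext_iff.1 heq k

/-- Two numbers of `[0, 1]` lying below the same levels `j / M` differ by at most `1 / M`. -/
lemma mul_sub_le_one_of_lt_imp_lt {M : ℕ} {x y : ℝ} (hx : 0 ≤ x) (hy : y ≤ 1)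
    (h : ∀ j : ℕ, j ≤ M → M * x < j → M * y < j) : M * (y - x) ≤ 1 := by
  by_contra! hlt
  have hMx : 0 ≤ M * x := by positivity
  have hfloor := Nat.floor_le hMx
  have hMy : M * y ≤ M := mul_le_of_le_one_right M.cast_nonneg hy
  have hj : ((⌊M * x⌋₊ + 1 : ℕ) : ℝ) < M * y := by
    push_cast
    linarith
  refine hj.not_gt (h _ ?_ ?_)
  · exact_mod_cast (hj.trans_le hMy).le
  · push_cast
    exact Nat.lt_floor_add_one _

/-- Two monotone, or two antitone, sequences in `[0, 1]` with equal crossing codes stay within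
`1 / M` of each other. -/
lemma mul_abs_sub_le_one_of_crossingCode_eq {n M : ℕ} {u v : ℕ → I}
    (huv : Monotone u ∧ Monotone v ∨ Antitone u ∧ Antitone v)
    (h : crossingCode n M (fun k ↦ u k) = crossingCode n M (fun k ↦ v k)) {k : ℕ} (hk : k < n) :
    M * |(u k : ℝ) - v k| ≤ 1 := by
  have hlt := fun j (hj : j ≤ M) ↦ lt_iff_lt_of_crossingCode_eq
    (u := fun k ↦ (u k : ℝ)) (v := fun k ↦ (v k : ℝ)) huv h hk hj
  rcases abs_cases ((u k : ℝ) - v k) with ⟨he, -⟩ | ⟨he, -⟩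
  · rw [he]
    exact mul_sub_le_one_of_lt_imp_lt (v k).2.1 (u k).2.2 fun j hj ↦ (hlt j hj).2
  · rw [he, neg_sub]
    exact mul_sub_le_one_of_lt_imp_lt (u k).2.1 (v k).2.2 fun j hj ↦ (hlt j hj).1

/-- If both coordinates of a self-map of the square vary monotonically along orbits, then
orbit segments of length `n` are distinguished at a fixed scale by polynomially many codes. -/
lemma coverMincard_le_pow_of_orbit_monotone {T : I × I → I × I}
    (hT₁ : (∀ p, p.1 ≤ (T p).1) ∨ ∀ p, (T p).1 ≤ p.1) (hT₂ : ∀ p, (T p).2 = p.2)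
    {ε : ℝ} {M : ℕ} (hM : 1 < M * ε) (n : ℕ) :
    Dynamics.coverMincard T Set.univ {p | dist p.1 p.2 < ε} n ≤
      ((n + 1) ^ (2 * (M + 1)) : ℕ) := by
  classical
  let code : I × I → (Fin (M + 1) → Fin (n + 1)) × (Fin (M + 1) → Fin (n + 1)) := fun p ↦
    (crossingCode n M fun k ↦ (T^[k] p).1, crossingCode n M fun k ↦ (T^[k] p).2)
  have hcover : Dynamics.IsDynCoverOf T Set.univ {p | dist p.1 p.2 < ε} n
      ((Finset.univ.image (Function.invFun code) : Finset (I × I)) : Set (I × I)) := by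
    intro p _
    have hcode : code (Function.invFun code (code p)) = code p := Function.invFun_eq ⟨p, rfl⟩
    refine ⟨Function.invFun code (code p), by simp, ?_⟩
    rw [Dynamics.mem_dynEntourage]
    intro k hk
    generalize Function.invFun code (code p) = q at hcode
    have hclose : ∀ {x y : I}, M * |(x : ℝ) - y| ≤ 1 → dist x y < ε := fun {x y} h ↦ by
      rw [Subtype.dist_eq, Real.dist_eq]
      exact lt_of_mul_lt_mul_left (h.trans_lt hM) M.cast_nonneg
    have hsnd : ∀ r : I × I, Monotone fun k ↦ (T^[k] r).2 := fun r ↦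
      monotone_nat_of_le_succ fun k ↦ by rw [Function.iterate_succ_apply', hT₂]
    refine max_lt (hclose ?_) (hclose ?_)
    · refine mul_abs_sub_le_one_of_crossingCode_eq (u := fun k ↦ (T^[k] p).1)
        (v := fun k ↦ (T^[k] q).1) ?_ (congrArg Prod.fst hcode).symm hk
      rcases hT₁ with h | h
      · have hfst : ∀ r : I × I, Monotone fun k ↦ (T^[k] r).1 := fun r ↦
          monotone_nat_of_le_succ fun k ↦ by
            rw [Function.iterate_succ_apply']
            exact h _
        exact .inl ⟨hfst p, hfst q⟩
      · have hfst : ∀ r : I × I, Antitone fun k ↦ (T^[k] r).1 := fun r ↦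
          antitone_nat_of_succ_le fun k ↦ by
            rw [Function.iterate_succ_apply']
            exact h _
        exact .inr ⟨hfst p, hfst q⟩
    · exact mul_abs_sub_le_one_of_crossingCode_eq (u := fun k ↦ (T^[k] p).2)
        (v := fun k ↦ (T^[k] q).2) (.inl ⟨hsnd p, hsnd q⟩) (congrArg Prod.snd hcode).symm hk
  refine hcover.coverMincard_le_card.trans (Nat.cast_le.2 (Finset.card_image_le.trans ?_))
  simp [two_mul, pow_add]

/-- A self-map of the square preserving horizontal lines and moving points horizontally in a fixed
direction has zero topological entropy. -/
lemma coverEntropy_eq_zero_of_orbit_monotone {T : I × I → I × I}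
    (hT₁ : (∀ p, p.1 ≤ (T p).1) ∨ ∀ p, (T p).1 ≤ p.1) (hT₂ : ∀ p, (T p).2 = p.2) :
    Dynamics.coverEntropy T Set.univ = 0 := by
  refine le_antisymm ?_ (Dynamics.coverEntropy_nonneg T Set.univ_nonempty)
  rw [Dynamics.coverEntropy_eq_iSup_basis Metric.uniformity_basis_dist]
  refine iSup₂_le fun ε hε ↦ ?_
  obtain ⟨M, hM⟩ := exists_nat_gt ε⁻¹
  have hM : 1 < M * ε := (inv_lt_iff_one_lt_mul₀ hε).1 hM
  refine expGrowthSup_nonpos_of_le_pow (d := 2 * (M + 1)) fun n ↦ ?_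
  have h := ENat.toENNReal_mono (coverMincard_le_pow_of_orbit_monotone hT₁ hT₂ hM n)
  simpa using h

/-- A continuous self-map of `[0, 1]` fixing `0` and `1` with no fixed points in `(0, 1)`
moves all points in the same direction. -/
lemma forall_le_or_forall_ge_of_ne {a : I → I} (ha : Continuous a) (h0 : a 0 = 0) (h1 : a 1 = 1)
    (hfix : ∀ x : I, (x : ℝ) ∈ Set.Ioo (0 : ℝ) 1 → a x ≠ x) :
    (∀ x, x ≤ a x) ∨ ∀ x, a x ≤ x := by
  by_contra! h
  obtain ⟨⟨x, hx⟩, ⟨y, hy⟩⟩ := h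
  have hIoo : ∀ z : I, a z ≠ z → z ∈ Set.Ioo (0 : I) 1 := fun z hz ↦
    ⟨unitInterval.pos_iff_ne_zero.2 fun h ↦ hz (by rw [h, h0]),
      unitInterval.lt_one_iff_ne_one.2 fun h ↦ hz (by rw [h, h1])⟩
  obtain ⟨z, hz, hzz⟩ := isPreconnected_Ioo.intermediate_value₂ (hIoo x hx.ne) (hIoo y hy.ne')
    ha.continuousOn continuousOn_id hx.le hy.le
  exact hfix z ⟨hz.1, hz.2⟩ hzz

/-- The straight-line isotopy from the identity to `a`, as a fibered self-map of the square. -/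
noncomputable def fiberedIsotopy (a : I → I) (p : I × I) : I × I :=
  (⟨(1 - p.2) * p.1 + p.2 * a p.1, (convex_Icc (0 : ℝ) 1) p.1.2 (a p.1).2
    (sub_nonneg.2 p.2.2.2) p.2.2.1 (sub_add_cancel _ _)⟩, p.2)

lemma continuous_fiberedIsotopy {a : I → I} (ha : Continuous a) :
    Continuous (fiberedIsotopy a) := by
  unfold fiberedIsotopy
  fun_prop

lemma injective_fiberedIsotopy {a : I → I} (ha : StrictMono a) :
    Function.Injective (fiberedIsotopy a) := by
  have hmono : ∀ y : I, StrictMono fun x ↦ (fiberedIsotopy a (x, y)).1 := by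
    intro y x x' hx
    have h₁ : (x : ℝ) < x' := hx
    have h₂ : (a x : ℝ) < a x' := ha hx
    have hy₀ := y.2.1
    have hy₁ := y.2.2
    change (1 - (y : ℝ)) * x + y * a x < (1 - (y : ℝ)) * x' + y * a x'
    rcases hy₀.eq_or_lt with h | h
    · rw [← h]
      linarith
    · exact add_lt_add_of_le_of_lt (mul_le_mul_of_nonneg_left h₁.le (by linarith))
        (mul_lt_mul_of_pos_left h₂ h)
  rintro ⟨x, y⟩ ⟨x', y'⟩ h
  obtain rfl : y = y' := congrArg Prod.snd h
  rw [(hmono y).injective (congrArg Prod.fst h)]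

lemma surjective_fiberedIsotopy {a : I → I} (ha : Continuous a) (h0 : a 0 = 0) (h1 : a 1 = 1) :
    Function.Surjective (fiberedIsotopy a) := by
  rintro ⟨x, y⟩
  have hcont : Continuous fun t ↦ (fiberedIsotopy a (t, y)).1 :=
    continuous_fst.comp ((continuous_fiberedIsotopy ha).comp (by fun_prop))
  obtain ⟨t, ht⟩ := mem_range_of_exists_le_of_exists_ge (c := x) hcont
    ⟨0, by
      have : (fiberedIsotopy a (0, y)).1 = 0 := Subtype.ext (by simp [fiberedIsotopy, h0])
      exact this.trans_le unitInterval.nonneg'⟩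
    ⟨1, by
      have : (fiberedIsotopy a (1, y)).1 = 1 := Subtype.ext (by simp [fiberedIsotopy, h1])
      exact unitInterval.le_one'.trans_eq this.symm⟩
  exact ⟨(t, y), Prod.ext ht rfl⟩

/-- **Lemma 3.12** (transported to the unit square). Let `a` be a homeomorphism of `[0,1]` with
`a 0 = 0`, `a 1 = 1` and `a x ≠ x` for `x ∈ (0,1)`. Then there is a homeomorphism `T` of the
square `[0,1] × [0,1]` with `T (x,1) = (a x, 1)`, fixing the boundary part
`({0,1} × [0,1]) ∪ ([0,1] × {0})` pointwise, and with topological entropy zero. -/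
theorem square_extension_entropy_zero (a : I ≃ₜ I) (h0 : a 0 = 0) (h1 : a 1 = 1)
    (hfix : ∀ x : I, (x : ℝ) ∈ Set.Ioo (0 : ℝ) 1 → a x ≠ x) :
    ∃ T : (I × I) ≃ₜ (I × I),
      (∀ x : I, T (x, 1) = (a x, 1)) ∧
      (∀ p : I × I, (p.1 = 0 ∨ p.1 = 1 ∨ p.2 = 0) → T p = p) ∧
      Dynamics.coverEntropy ⇑T Set.univ = 0 := by
  have hmono : StrictMono a := a.continuous.strictMono_of_inj_boundedOrder
    (show a 0 ≤ a 1 by rw [h0, h1]; exact zero_le_one) a.injective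
  let e : I × I ≃ I × I := Equiv.ofBijective (fiberedIsotopy a)
    ⟨injective_fiberedIsotopy hmono, surjective_fiberedIsotopy a.continuous h0 h1⟩
  have he : Continuous e := continuous_fiberedIsotopy a.continuous
  refine ⟨he.homeoOfEquivCompactToT2, fun x ↦ ?_, ?_, ?_⟩
  · change fiberedIsotopy a (x, 1) = (a x, 1)
    simp [fiberedIsotopy]
  · rintro ⟨x, y⟩ h
    change fiberedIsotopy a (x, y) = (x, y)
    refine Prod.ext (Subtype.ext ?_) rfl
    change (1 - (y : ℝ)) * x + y * a x = x
    rcases h with rfl | rfl | rfl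
    · simp [h0]
    · simp [h1]
    · simp
  · change Dynamics.coverEntropy (fiberedIsotopy a) Set.univ = 0
    refine coverEntropy_eq_zero_of_orbit_monotone ?_ fun _ ↦ rfl
    refine (forall_le_or_forall_ge_of_ne a.continuous h0 h1 hfix).imp (fun h p ↦ ?_) fun h p ↦ ?_
    · change (p.1 : ℝ) ≤ (1 - (p.2 : ℝ)) * p.1 + p.2 * a p.1
      have := mul_le_mul_of_nonneg_left (show (p.1 : ℝ) ≤ a p.1 from h p.1) p.2.2.1
      linarith
    · change (1 - (p.2 : ℝ)) * p.1 + p.2 * a p.1 ≤ (p.1 : ℝ)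
      have := mul_le_mul_of_nonneg_left (show (a p.1 : ℝ) ≤ p.1 from h p.1) p.2.2.1
      linarith
end

section
/- Lemma 3.13: Let a : [0,1] → [0,1] be a homeomorphism with a(0) = 0, a(1) = 1 and a(x) ≠ x for all x ∈ (0,1). Define α : [0,1] × [0,1] → [0,1] × [0,1] by α(x,y) = (y·a(x) + (1−y)·x, y). Then α is a homeomorphism of the square onto itself and its topological entropy is zero: h(α) = 0. -/
open unitInterval

lemma convexCombo_mem_unitInterval (x y z : ℝ)
    (hx : x ∈ Set.Icc (0 : ℝ) 1) (hy : y ∈ Set.Icc (0 : ℝ) 1) (hz : z ∈ Set.Icc (0 : ℝ) 1) :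
    y * z + (1 - y) * x ∈ Set.Icc (0 : ℝ) 1 := by
  obtain ⟨hx0, hx1⟩ := hx
  obtain ⟨hy0, hy1⟩ := hy
  obtain ⟨hz0, hz1⟩ := hz
  constructor
  · nlinarith
  · nlinarith

/-- The map `α (x, y) = (y·a(x) + (1−y)·x, y)` on the unit square. -/
noncomputable def alphaMap (a : I ≃ₜ I) : I × I → I × I := fun p =>
  (⟨(p.2 : ℝ) * (a p.1 : ℝ) + (1 - (p.2 : ℝ)) * (p.1 : ℝ),
    convexCombo_mem_unitInterval _ _ _ p.1.2 p.2.2 (a p.1).2⟩, p.2)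

section

open Set Filter Topology Uniformity
open scoped SetRel

/-- The orbits of length `n` of a strictly monotone surjective self-map of the unit interval are
`1 / (K + 1)`-shadowed by those of at most `n * (K + 2)` points. -/
lemma exists_finset_shadowing_of_strictMono {f : I → I} (hf : StrictMono f)
    (hs : Function.Surjective f) (K : ℕ) {n : ℕ} (hn : n ≠ 0) :
    ∃ s : Finset I, s.card ≤ n * (K + 2) ∧
      ∀ x, ∃ p ∈ s, ∀ i < n, dist (f^[i] x) (f^[i] p) < 1 / ((K : ℝ) + 1) := by
  have hK : (0 : ℝ) < (K : ℝ) + 1 := by positivity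
  have hmesh : ∀ i j : ℕ, ∃ q : I, j ≤ K + 1 → (f^[i] q : ℝ) = j / ((K : ℝ) + 1) := by
    intro i j
    by_cases hj : j ≤ K + 1
    · have hmem : (j : ℝ) / ((K : ℝ) + 1) ∈ Icc (0 : ℝ) 1 :=
        ⟨by positivity, (div_le_one hK).2 (by exact_mod_cast hj)⟩
      obtain ⟨q, hq⟩ := hs.iterate i ⟨_, hmem⟩
      exact ⟨q, fun _ ↦ by rw [hq]⟩
    · exact ⟨0, fun h ↦ absurd h hj⟩
  choose q hq using hmesh
  classical
  set P : Finset I := (Finset.range n ×ˢ Finset.range (K + 2)).image (fun ij ↦ q ij.1 ij.2)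
  have mem_P : ∀ i < n, ∀ j ≤ K + 1, q i j ∈ P := fun i hi j hj ↦
    Finset.mem_image.2 ⟨(i, j), by simp only [Finset.mem_product, Finset.mem_range]; omega, rfl⟩
  refine ⟨P, Finset.card_image_le.trans (by simp), fun x ↦ ?_⟩
  have hne : (P.filter (· ≤ x)).Nonempty := by
    refine ⟨q 0 0, Finset.mem_filter.2 ⟨mem_P 0 (Nat.pos_of_ne_zero hn) 0 (by omega), ?_⟩⟩
    have h := hq 0 0 (by omega)
    simp only [Function.iterate_zero, id_eq, Nat.cast_zero, zero_div] at h
    exact Subtype.coe_le_coe.1 (h ▸ x.2.1)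
  obtain ⟨hpP, hpx⟩ := Finset.mem_filter.1 (Finset.max'_mem _ hne)
  refine ⟨_, hpP, fun i hi ↦ ?_⟩
  set p := (P.filter (· ≤ x)).max' hne
  have hfi : StrictMono f^[i] := hf.iterate i
  have hle : (f^[i] p : ℝ) ≤ f^[i] x := hfi.monotone hpx
  have hx1 : (f^[i] x : ℝ) ≤ 1 := (f^[i] x).2.2
  have hx0 : (0 : ℝ) ≤ f^[i] x := (f^[i] x).2.1
  set j := ⌊(f^[i] x : ℝ) * ((K : ℝ) + 1)⌋₊
  have hjx : (j : ℝ) ≤ (f^[i] x : ℝ) * ((K : ℝ) + 1) := Nat.floor_le (by positivity)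
  have hxj : (f^[i] x : ℝ) * ((K : ℝ) + 1) < j + 1 := Nat.lt_floor_add_one _
  have hjK : j ≤ K + 1 := by
    have : (j : ℝ) ≤ ((K + 1 : ℕ) : ℝ) := by push_cast; nlinarith
    exact_mod_cast this
  have hjp : (j : ℝ) / ((K : ℝ) + 1) ≤ f^[i] p := by
    have hqx : q i j ≤ x := hfi.le_iff_le.1 <| Subtype.coe_le_coe.1 <| by
      rw [hq i j hjK]
      exact (div_le_iff₀ hK).2 hjx
    rw [← hq i j hjK]
    exact hfi.monotone (Finset.le_max' _ _ (Finset.mem_filter.2 ⟨mem_P i hi j hjK, hqx⟩))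
  rw [Subtype.dist_eq, Real.dist_eq, abs_of_nonneg (sub_nonneg.2 hle)]
  have : (f^[i] x : ℝ) < (j + 1) / ((K : ℝ) + 1) := (lt_div_iff₀ hK).2 hxj
  rw [add_div] at this
  linarith

lemma tendsto_ennreal_log_nat_mul_div_atTop {C : ℕ} (hC : C ≠ 0) :
    Tendsto (fun n : ℕ ↦ ENNReal.log ((n * C : ℕ) : ENNReal) / (n : EReal)) atTop (𝓝 0) := by
  have hreal : Tendsto (fun n : ℕ ↦ Real.log ((n * C : ℕ) : ℝ) / n) atTop (𝓝 0) := by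
    have h : Tendsto (fun x : ℝ ↦ Real.log x / (1 * x + 0)) atTop (𝓝 0) := by
      simpa using Real.tendsto_pow_log_div_mul_add_atTop 1 0 1 one_ne_zero
    have hCt : Tendsto (fun n : ℕ ↦ ((n * C : ℕ) : ℝ)) atTop atTop :=
      tendsto_natCast_atTop_atTop.comp (tendsto_id.atTop_mul_const' (Nat.pos_of_ne_zero hC))
    have h' := (h.comp hCt).mul_const (C : ℝ)
    rw [zero_mul] at h'
    refine h'.congr fun n ↦ ?_
    have : (C : ℝ) ≠ 0 := by exact_mod_cast hC
    rcases eq_or_ne n 0 with rfl | hn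
    · simp
    · simp only [Function.comp_apply, Nat.cast_mul]
      field_simp
      ring_nf
  refine ((continuous_coe_real_ereal.tendsto 0).comp hreal).congr' ?_
  filter_upwards [eventually_gt_atTop 0] with n hn
  have hpos : (0 : ℝ) < ((n * C : ℕ) : ℝ) := by
    exact_mod_cast Nat.mul_pos hn (Nat.pos_of_ne_zero hC)
  rw [← ENNReal.ofReal_natCast, ENNReal.log_ofReal_of_pos hpos, Function.comp_apply,
    EReal.coe_div, EReal.coe_natCast]

/-- A continuous self-map of the square which preserves every horizontal fibre and restricts there
to a strictly monotone surjection has entropy zero. -/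
lemma coverEntropy_eq_zero_of_fiberwise_strictMono {T : I × I → I × I} (hT : Continuous T)
    {f : I → I → I} (hTf : ∀ p, T p = (f p.2 p.1, p.2)) (hf : ∀ y, StrictMono (f y))
    (hs : ∀ y, Function.Surjective (f y)) :
    Dynamics.coverEntropy T univ = 0 := by
  have hiter : ∀ (n : ℕ) (x y : I), T^[n] (x, y) = ((f y)^[n] x, y) := by
    intro n x y
    induction n with
    | zero => rfl
    | succ n ih => rw [Function.iterate_succ_apply', ih, hTf, Function.iterate_succ_apply']
  refine le_antisymm (iSup₂_le fun U hU ↦ ?_) (Dynamics.coverEntropy_nonneg T univ_nonempty)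
  obtain ⟨V, hV, hVsymm, hVU⟩ := comp_symm_mem_uniformity_sets hU
  refine (Dynamics.coverEntropyEntourage_antitone T univ hVU).trans ?_
  obtain ⟨ε, hε, hεV⟩ := Metric.mem_uniformity_dist.1 hV
  obtain ⟨K, hKε⟩ := exists_nat_one_div_lt hε
  refine ge_of_tendsto (tendsto_ennreal_log_nat_mul_div_atTop (C := K + 2) (by omega)) ?_
  filter_upwards [eventually_ne_atTop 0] with n hn
  have hloc : ∀ y : I, ∃ W ∈ 𝓝 y, Dynamics.coverEntropyEntourage T (Prod.snd ⁻¹' W) (V ○ V) ≤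
      ENNReal.log ((n * (K + 2) : ℕ) : ENNReal) / (n : EReal) := by
    intro y
    obtain ⟨s, hcard, hshadow⟩ := exists_finset_shadowing_of_strictMono (hf y) (hs y) K hn
    classical
    set D : Set ((I × I) × (I × I)) :=
      Dynamics.dynEntourage T {p : (I × I) × (I × I) | dist p.1 p.2 < ε} n
    have hD : IsOpen D := isOpen.dynEntourage hT (isOpen_lt continuous_dist continuous_const) n
    have hopen : IsOpen (⋃ c ∈ s, {p : I × I | (p, (c, y)) ∈ D}) :=
      isOpen_biUnion fun c _ ↦ hD.preimage (by fun_prop)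
    have hsub : (univ : Set I) ×ˢ {y} ⊆ ⋃ c ∈ s, {p : I × I | (p, (c, y)) ∈ D} := by
      rintro ⟨x, y'⟩ ⟨-, rfl : y' = y⟩
      obtain ⟨c, hc, h⟩ := hshadow x
      refine mem_iUnion₂.2 ⟨c, hc, Dynamics.mem_dynEntourage.2 fun k hk ↦ ?_⟩
      simp only [mem_ofPred_eq, hiter, Prod.dist_eq, dist_self]
      exact max_lt ((h k hk).trans hKε) hε
    obtain ⟨u, W, -, hW, hu, hyW, huW⟩ :=
      generalized_tube_lemma isCompact_univ isCompact_singleton hopen hsub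
    refine ⟨W, hW.mem_nhds (hyW rfl), ?_⟩
    have hcover : Dynamics.IsDynCoverOf T (Prod.snd ⁻¹' W) V n
        (s.image fun c ↦ (c, y) : Finset (I × I)) := by
      intro p hp
      obtain ⟨c, hc, hpc⟩ := mem_iUnion₂.1 (huW ⟨hu (mem_univ p.1), hp⟩)
      exact ⟨(c, y), by simpa using hc,
        Dynamics.dynEntourage_monotone T n (fun q hq ↦ hεV hq) hpc⟩
    have hinv : MapsTo T (Prod.snd ⁻¹' W) (Prod.snd ⁻¹' W) := fun p hp ↦ by
      rw [mem_preimage, hTf]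
      exact hp
    refine (hcover.coverEntropyEntourage_le_log_card_div hinv hn).trans ?_
    refine EReal.monotone_div_right_of_nonneg n.cast_nonneg' (ENNReal.log_monotone ?_)
    exact_mod_cast Finset.card_image_le.trans hcard
  have := isCompact_univ.induction_on (X := I)
    (p := fun W ↦ Dynamics.coverEntropyEntourage T (Prod.snd ⁻¹' W) (V ○ V) ≤
      ENNReal.log ((n * (K + 2) : ℕ) : ENNReal) / (n : EReal))
    (by simp)
    (fun s t hst ht ↦
      (Dynamics.coverEntropyEntourage_monotone T _ (preimage_mono hst)).trans ht)
    (fun s t h h' ↦ by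
      rw [preimage_union, Dynamics.coverEntropyEntourage_union]
      exact max_le h h')
    (fun y _ ↦ by simpa only [nhdsWithin_univ] using hloc y)
  simpa using this

lemma continuous_alphaMap (a : I ≃ₜ I) : Continuous (alphaMap a) := by
  unfold alphaMap
  have := a.continuous
  fun_prop

lemma strictMono_fst_alphaMap {a : I ≃ₜ I} (ha : StrictMono a) (y : I) :
    StrictMono fun x ↦ (alphaMap a (x, y)).1 := by
  intro x x' h
  have h1 : (x : ℝ) < x' := h
  have h2 : (a x : ℝ) < a x' := ha h
  have hy0 : (0 : ℝ) ≤ y := y.2.1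
  have hy1 : (y : ℝ) ≤ 1 := y.2.2
  simp only [alphaMap, Subtype.mk_lt_mk]
  rcases hy0.eq_or_lt with hy | hy
  · simpa [← hy] using h1
  · have := mul_lt_mul_of_pos_left h2 hy
    have := mul_le_mul_of_nonneg_left h1.le (sub_nonneg.2 hy1)
    linarith

lemma surjective_fst_alphaMap {a : I ≃ₜ I} (h0 : a 0 = 0) (h1 : a 1 = 1) (y : I) :
    Function.Surjective fun x ↦ (alphaMap a (x, y)).1 := by
  have hc : Continuous fun x ↦ (alphaMap a (x, y)).1 :=
    ((continuous_alphaMap a).comp (by fun_prop)).fst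
  intro z
  have hz : z ∈ Icc (alphaMap a (0, y)).1 (alphaMap a (1, y)).1 := by
    constructor <;> rw [← Subtype.coe_le_coe]
    · simpa [alphaMap, h0] using z.2.1
    · simpa [alphaMap, h1] using z.2.2
  obtain ⟨x, -, hx⟩ := intermediate_value_Icc zero_le_one hc.continuousOn hz
  exact ⟨x, hx⟩

end

/-- **Lemma 3.13.** Let `a` be a homeomorphism of `[0,1]` with `a 0 = 0`, `a 1 = 1` and
`a x ≠ x` for `x ∈ (0,1)`. Then `α (x,y) = (y·a(x) + (1−y)·x, y)` is a homeomorphism of the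
square `[0,1] × [0,1]` onto itself and its topological entropy is zero. -/
theorem alphaMap_isHomeomorph_entropy_zero (a : I ≃ₜ I) (h0 : a 0 = 0) (h1 : a 1 = 1)
    (hfix : ∀ x : I, (x : ℝ) ∈ Set.Ioo (0 : ℝ) 1 → a x ≠ x) :
    (∃ h : (I × I) ≃ₜ (I × I), ⇑h = alphaMap a) ∧
      Dynamics.coverEntropy (alphaMap a) Set.univ = 0 := by
  have ha : StrictMono a :=
    a.continuous.strictMono_of_inj_boundedOrder (h0.trans_le bot_le) a.injective
  have hmono := strictMono_fst_alphaMap ha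
  have hsurj := surjective_fst_alphaMap h0 h1
  have hbij : Function.Bijective (alphaMap a) := by
    constructor
    · rintro ⟨x, y⟩ ⟨x', y'⟩ h
      obtain rfl : y = y' := congrArg Prod.snd h
      rw [(hmono y).injective (congrArg Prod.fst h)]
    · rintro ⟨z, y⟩
      obtain ⟨x, hx⟩ := hsurj y z
      exact ⟨(x, y), Prod.ext hx rfl⟩
  exact ⟨⟨Continuous.homeoOfEquivCompactToT2 (f := Equiv.ofBijective _ hbij)
      (continuous_alphaMap a), rfl⟩,
    coverEntropy_eq_zero_of_fiberwise_strictMono (continuous_alphaMap a) (fun _ ↦ rfl) hmono hsurj⟩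
end

section
/- Iterate comparison claim from the proof of Lemma 3.13: Let a : [0,1] → [0,1] be continuous and strictly increasing with a(0) = 0, a(1) = 1 and a(x) > x for all x ∈ (0,1). For y ∈ [0,1] define α_y : [0,1] → [0,1] by α_y(x) = y·a(x) + (1−y)·x. Then for every x ∈ (0,1), every integer k ≥ 1, and all y, y' with 0 ≤ y < y' ≤ 1, the k-th iterates satisfy α_{y'}^{∘k}(x) > α_y^{∘k}(x). In particular, for fixed x ∈ (0,1) and k ≥ 1 the map y ↦ α_y^{∘k}(x) is strictly increasing on [0,1], so each curve C_x^k = {(α_y^{∘k}(x), y) : y ∈ [0,1]} meets every vertical segment {x'} × [0,1] in at most one point. -/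
open Set

theorem interpolation_mapsTo_Ioo {a : ℝ → ℝ} (ha_mono : StrictMonoOn a (Icc (0 : ℝ) 1))
    (ha1 : a 1 = 1) (ha_gt : ∀ x ∈ Ioo (0 : ℝ) 1, a x > x) {y : ℝ} (hy : y ∈ Icc (0 : ℝ) 1) :
    MapsTo (fun z => y * a z + (1 - y) * z) (Ioo 0 1) (Ioo 0 1) := by
  intro z hz
  have hgt := ha_gt z hz
  have hlt : a z < 1 := ha1 ▸ ha_mono (Ioo_subset_Icc_self hz) (right_mem_Icc.2 zero_le_one) hz.2
  exact convex_Ioo (0 : ℝ) 1 ⟨hz.1.trans hgt, hlt⟩ hz hy.1 (sub_nonneg.2 hy.2)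
    (add_sub_cancel y 1)

theorem interpolation_monotoneOn {a : ℝ → ℝ} (ha_mono : StrictMonoOn a (Icc (0 : ℝ) 1))
    {y : ℝ} (hy : y ∈ Icc (0 : ℝ) 1) :
    MonotoneOn (fun z => y * a z + (1 - y) * z) (Icc 0 1) := by
  intro u hu v hv huv
  exact add_le_add (mul_le_mul_of_nonneg_left (ha_mono.monotoneOn hu hv huv) hy.1)
    (mul_le_mul_of_nonneg_left huv (sub_nonneg.2 hy.2))

/-- If `f` is monotone on an invariant set and `f < g` there, then the iterates of `f` stay
strictly below those of `g`. -/
theorem iterate_lt_iterate_of_monotoneOn {α : Type*} [Preorder α] {f g : α → α} {s : Set α}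
    (hf : MapsTo f s s) (hg : MapsTo g s s) (hmono : MonotoneOn f s)
    (hlt : ∀ z ∈ s, f z < g z) {x : α} (hx : x ∈ s) {k : ℕ} (hk : 1 ≤ k) :
    f^[k] x < g^[k] x := by
  induction k, hk using Nat.le_induction with
  | base => exact hlt x hx
  | succ n _ ih =>
    rw [Function.iterate_succ_apply', Function.iterate_succ_apply']
    exact (hmono (hf.iterate n hx) (hg.iterate n hx) ih.le).trans_lt (hlt _ (hg.iterate n hx))

/-- **Iterate comparison claim from the proof of Lemma 3.13.** Let `a : [0,1] → [0,1]` be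
continuous and strictly increasing with `a 0 = 0`, `a 1 = 1` and `a x > x` on `(0,1)`. For
`y ∈ [0,1]` let `α_y x = y·a x + (1−y)·x`. Then for every `x ∈ (0,1)`, `k ≥ 1` and
`0 ≤ y < y' ≤ 1` one has `α_{y'}^[k] x > α_y^[k] x`; in particular, each curve
`C_x^k = {(α_y^[k] x, y)}` meets every vertical segment `{x'} × [0,1]` in at most one point. -/
theorem iterate_comparison (a : ℝ → ℝ)
    (ha_cont : ContinuousOn a (Icc (0 : ℝ) 1))
    (ha_mono : StrictMonoOn a (Icc (0 : ℝ) 1))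
    (ha0 : a 0 = 0) (ha1 : a 1 = 1)
    (ha_gt : ∀ x ∈ Ioo (0 : ℝ) 1, a x > x) :
    (∀ x ∈ Ioo (0 : ℝ) 1, ∀ k : ℕ, 1 ≤ k → ∀ y y' : ℝ, 0 ≤ y → y < y' → y' ≤ 1 →
      (fun z => y' * a z + (1 - y') * z)^[k] x > (fun z => y * a z + (1 - y) * z)^[k] x) ∧
    (∀ x ∈ Ioo (0 : ℝ) 1, ∀ k : ℕ, 1 ≤ k → ∀ x' : ℝ,
      Set.Subsingleton
        {y : ℝ | y ∈ Icc (0 : ℝ) 1 ∧ (fun z => y * a z + (1 - y) * z)^[k] x = x'}) := by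
  have key : ∀ x ∈ Ioo (0 : ℝ) 1, ∀ k : ℕ, 1 ≤ k → ∀ y y' : ℝ, 0 ≤ y → y < y' → y' ≤ 1 →
      (fun z => y' * a z + (1 - y') * z)^[k] x > (fun z => y * a z + (1 - y) * z)^[k] x := by
    intro x hx k hk y y' hy hyy' hy'
    have hyI : y ∈ Icc (0 : ℝ) 1 := ⟨hy, hyy'.le.trans hy'⟩
    have hyI' : y' ∈ Icc (0 : ℝ) 1 := ⟨hy.trans hyy'.le, hy'⟩
    refine iterate_lt_iterate_of_monotoneOn
      (interpolation_mapsTo_Ioo ha_mono ha1 ha_gt hyI)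
      (interpolation_mapsTo_Ioo ha_mono ha1 ha_gt hyI')
      ((interpolation_monotoneOn ha_mono hyI).mono Ioo_subset_Icc_self) (fun z hz => ?_) hx hk
    linarith [mul_pos (sub_pos.2 hyy') (sub_pos.2 (ha_gt z hz))]
  refine ⟨key, ?_⟩
  rintro x hx k hk x' y ⟨hy, hyx⟩ y' ⟨hy', hyx'⟩
  rcases lt_trichotomy y y' with h | h | h
  · exact absurd (hyx.trans hyx'.symm) (key x hx k hk y y' hy.1 h hy'.2).ne
  · exact h
  · exact absurd (hyx'.trans hyx.symm) (key x hx k hk y' y hy'.1 h hy.2).ne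
end

section
/- Lemma 8.4: Let n be a prime number, let α be a finite type with n elements, and let H be a subgroup of the symmetric group Perm(α) which is abelian and acts transitively on α (i.e., for all x, y ∈ α there exists σ ∈ H with σ(x) = y). Then H is generated by an n-cycle: there exists σ ∈ H which is a cycle whose support is all of α, and H equals the cyclic subgroup generated by σ. -/
/-- Evaluation at any point is a bijection from an abelian transitive permutation group. -/
theorem eval_bijective_of_abelian_transitive {α : Type*} {H : Subgroup (Equiv.Perm α)}
    (habelian : ∀ g ∈ H, ∀ h ∈ H, g * h = h * g)
    (htrans : ∀ x y : α, ∃ σ ∈ H, σ x = y) (x : α) :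
    Function.Bijective fun g : H => (g : Equiv.Perm α) x := by
  refine ⟨fun g h hgh => Subtype.ext (Equiv.ext fun y => ?_), fun y => ?_⟩
  · obtain ⟨k, hk, rfl⟩ := htrans x y
    have hgh' : (g : Equiv.Perm α) x = (h : Equiv.Perm α) x := hgh
    rw [← Equiv.Perm.mul_apply, ← Equiv.Perm.mul_apply, habelian g g.2 k hk,
      habelian h h.2 k hk, Equiv.Perm.mul_apply, Equiv.Perm.mul_apply, hgh']
  · obtain ⟨k, hk, hkx⟩ := htrans x y
    exact ⟨⟨k, hk⟩, hkx⟩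

/-- **Lemma 8.4.** Let `n` be a prime number and `α` a finite type with `n` elements. Any
abelian subgroup `H` of the symmetric group `Perm α` acting transitively on `α` is generated
by an `n`-cycle: there is `σ ∈ H` which is a cycle with full support, and `H = ⟨σ⟩`. -/
theorem abelian_transitive_subgroup_is_cyclic
    {α : Type*} [Fintype α] [DecidableEq α] {n : ℕ} (hn : n.Prime)
    (hcard : Fintype.card α = n) (H : Subgroup (Equiv.Perm α))
    (habelian : ∀ g ∈ H, ∀ h ∈ H, g * h = h * g)
    (htrans : ∀ x y : α, ∃ σ ∈ H, σ x = y) :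
    ∃ σ ∈ H, σ.IsCycle ∧ σ.support = Finset.univ ∧ H = Subgroup.zpowers σ := by
  subst hcard
  have : Fact (Fintype.card α).Prime := ⟨hn⟩
  obtain ⟨x⟩ : Nonempty α := Fintype.card_pos_iff.mp hn.pos
  have hH : Nat.card H = Fintype.card α :=
    (Nat.card_eq_of_bijective _ (eval_bijective_of_abelian_transitive habelian htrans x)).trans
      Nat.card_eq_fintype_card
  obtain ⟨⟨σ, hσ⟩, hord⟩ := exists_prime_orderOf_dvd_card' (G := H) _ hH.symm.dvd
  rw [Subgroup.orderOf_mk] at hord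
  have hcycle := Equiv.Perm.isCycle_of_prime_order'' hn hord
  refine ⟨σ, hσ, hcycle, Finset.eq_univ_of_card _ (hcycle.orderOf.symm.trans hord), ?_⟩
  refine (Subgroup.eq_of_le_of_card_ge (Subgroup.zpowers_le.mpr hσ) ?_).symm
  rw [hH, Nat.card_zpowers, hord]
end

section
/- Lemma 8.8: In the braid group B₃, for every nonzero integer k the centralizer of σ₁^k equals {σ₁^{k'}·Δ₃^{2ℓ'} : k', ℓ' ∈ ℤ}; that is, an element b ∈ B₃ commutes with σ₁^k if and only if b = σ₁^{k'}·Δ₃^{2ℓ'} for some integers k' and ℓ'. -/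
/-- The single braid relator `σ₁σ₂σ₁σ₂⁻¹σ₁⁻¹σ₂⁻¹` for the braid group `B₃`. -/
def braidRels3 : Set (FreeGroup (Fin 2)) :=
  {FreeGroup.of 0 * FreeGroup.of 1 * FreeGroup.of 0 *
    (FreeGroup.of 1)⁻¹ * (FreeGroup.of 0)⁻¹ * (FreeGroup.of 1)⁻¹}

/-- The braid group `B₃ = ⟨σ₁, σ₂ ∣ σ₁σ₂σ₁ = σ₂σ₁σ₂⟩`. -/
abbrev BraidGroup3 : Type := PresentedGroup braidRels3

/-- The generator `σ₁` of `B₃`. -/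
def braidσ₁ : BraidGroup3 := PresentedGroup.of 0

/-- The generator `σ₂` of `B₃`. -/
def braidσ₂ : BraidGroup3 := PresentedGroup.of 1

/-- The Garside element `Δ₃ = σ₁σ₂σ₁` of `B₃`. -/
def braidΔ₃ : BraidGroup3 := braidσ₁ * braidσ₂ * braidσ₁

namespace BraidGroup3

/-- The braid relation `σ₁σ₂σ₁ = σ₂σ₁σ₂`. -/
theorem braid_relation : braidσ₁ * braidσ₂ * braidσ₁ = braidσ₂ * braidσ₁ * braidσ₂ := by
  have h : (PresentedGroup.mk braidRels3) (FreeGroup.of 0 * FreeGroup.of 1 * FreeGroup.of 0 *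
      (FreeGroup.of 1)⁻¹ * (FreeGroup.of 0)⁻¹ * (FreeGroup.of 1)⁻¹) = 1 :=
    PresentedGroup.one_of_mem rfl
  simp only [map_mul, map_inv] at h
  have h' : braidσ₁ * braidσ₂ * braidσ₁ * braidσ₂⁻¹ * braidσ₁⁻¹ * braidσ₂⁻¹ = 1 := h
  rw [mul_inv_eq_one, mul_inv_eq_iff_eq_mul, mul_inv_eq_iff_eq_mul] at h'
  exact h'

theorem Δ_mul_σ₁ : braidΔ₃ * braidσ₁ = braidσ₂ * braidΔ₃ := by
  rw [braidΔ₃]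
  nth_rw 1 [braid_relation]
  simp only [mul_assoc]

theorem Δ_mul_σ₂ : braidΔ₃ * braidσ₂ = braidσ₁ * braidΔ₃ := by
  rw [braidΔ₃]
  nth_rw 2 [braid_relation]
  simp only [mul_assoc]

theorem closure_generators : Subgroup.closure {braidσ₁, braidσ₂} = ⊤ := by
  rw [← PresentedGroup.closure_range_of]
  congr 1
  ext b
  simp [braidσ₁, braidσ₂, Fin.exists_fin_two, eq_comm]

/-- The square of the Garside element is central. -/
theorem commute_Δ_sq (b : BraidGroup3) : Commute (braidΔ₃ ^ 2) b := by
  have h : b ∈ Subgroup.closure {braidσ₁, braidσ₂} := by simp [closure_generators]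
  induction h using Subgroup.closure_induction with
  | mem x hx =>
    rcases hx with rfl | rfl
    · rw [Commute, SemiconjBy, sq, mul_assoc, Δ_mul_σ₁, ← mul_assoc, Δ_mul_σ₂, mul_assoc]
    · rw [Commute, SemiconjBy, sq, mul_assoc, Δ_mul_σ₂, ← mul_assoc, Δ_mul_σ₁, mul_assoc]
  | one => exact Commute.one_right _
  | mul x y _ _ hx hy => exact hx.mul_right hy
  | inv x _ hx => exact hx.inv_right

/-- The subgroup `{σ₁^k Δ₃^(2l)}` generated by `σ₁` and `Δ₃²`. -/
def cuspSubgroup : Subgroup BraidGroup3 where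
  carrier := {b | ∃ k l : ℤ, b = braidσ₁ ^ k * (braidΔ₃ ^ 2) ^ l}
  one_mem' := ⟨0, 0, by simp⟩
  mul_mem' := by
    rintro _ _ ⟨k, l, rfl⟩ ⟨k', l', rfl⟩
    refine ⟨k + k', l + l', ?_⟩
    rw [zpow_add, zpow_add, mul_assoc, mul_assoc, ← mul_assoc _ (braidσ₁ ^ k'),
      ((commute_Δ_sq (braidσ₁ ^ k')).zpow_left l).eq, mul_assoc]
  inv_mem' := by
    rintro _ ⟨k, l, rfl⟩
    refine ⟨-k, -l, ?_⟩
    rw [mul_inv_rev, zpow_neg, zpow_neg]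
    exact ((commute_Δ_sq ((braidσ₁ ^ k)⁻¹)).zpow_left l).inv_left.eq

theorem mem_cuspSubgroup {b : BraidGroup3} :
    b ∈ cuspSubgroup ↔ ∃ k l : ℤ, b = braidσ₁ ^ k * braidΔ₃ ^ (2 * l) := by
  simp only [zpow_mul, zpow_ofNat]
  rfl

theorem σ₁_mem_cuspSubgroup : braidσ₁ ∈ cuspSubgroup := ⟨1, 0, by simp⟩

theorem Δ_sq_mem_cuspSubgroup : braidΔ₃ ^ 2 ∈ cuspSubgroup := ⟨0, 1, by simp⟩

theorem Δ_smul_Δ_smul (y : BraidGroup3 ⧸ cuspSubgroup) : braidΔ₃ • braidΔ₃ • y = y := by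
  induction y using QuotientGroup.induction_on with
  | H b =>
    rw [smul_smul, ← sq, MulAction.Quotient.smul_coe, smul_eq_mul, (commute_Δ_sq b).eq,
      QuotientGroup.mk_mul_of_mem _ Δ_sq_mem_cuspSubgroup]

theorem den_neg_inv_fract_lt {x : ℚ} (hx : Int.fract x ≠ 0) :
    (-(Int.fract x)⁻¹).den < x.den := by
  have hpos : 0 < Int.fract x := lt_of_le_of_ne (Int.fract_nonneg x) hx.symm
  have hnum : 0 < (Int.fract x).num := Rat.num_pos.mpr hpos
  have hden : (Int.fract x).den = x.den := by
    rw [Int.fract, sub_eq_add_neg, ← Int.cast_neg, Rat.add_intCast_den]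
  have hlt : (Int.fract x).num < (Int.fract x).den := Rat.num_lt_denom_iff.mpr (Int.fract_lt_one x)
  rw [Rat.den_neg_eq_den, Rat.den_inv, if_neg hnum.ne']
  omega

/-- The coset of `cuspSubgroup` attached to a rational number by its continued fraction
expansion. -/
noncomputable def cuspCoset (x : ℚ) : BraidGroup3 ⧸ cuspSubgroup :=
  braidσ₁ ^ ⌊x⌋ • braidΔ₃ •
    if Int.fract x = 0 then ((1 : BraidGroup3) : BraidGroup3 ⧸ cuspSubgroup)
    else cuspCoset (-(Int.fract x)⁻¹)
termination_by x.den
decreasing_by exact den_neg_inv_fract_lt ‹_›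

theorem cuspCoset_add_one (x : ℚ) : cuspCoset (x + 1) = braidσ₁ • cuspCoset x := by
  rw [cuspCoset, cuspCoset.eq_1 x, Int.floor_add_one, Int.fract_add_one, add_comm, zpow_add,
    zpow_one, mul_smul]

theorem cuspCoset_sub_one (x : ℚ) : cuspCoset (x - 1) = braidσ₁⁻¹ • cuspCoset x := by
  rw [eq_inv_smul_iff, ← cuspCoset_add_one, sub_add_cancel]

theorem cuspCoset_zero :
    cuspCoset 0 = braidΔ₃ • ((1 : BraidGroup3) : BraidGroup3 ⧸ cuspSubgroup) := by
  rw [cuspCoset]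
  simp

theorem cuspCoset_of_mem_Ioo {x : ℚ} (h0 : 0 < x) (h1 : x < 1) :
    cuspCoset x = braidΔ₃ • cuspCoset (-x⁻¹) := by
  have hf : Int.fract x = x := Int.fract_eq_self.mpr ⟨h0.le, h1⟩
  have hfl : ⌊x⌋ = 0 := Int.floor_eq_zero_iff.mpr ⟨h0.le, h1⟩
  rw [cuspCoset, hf, hfl, if_neg h0.ne', zpow_zero, one_smul]

theorem σ₂_eq : braidσ₂ = braidσ₁⁻¹ * braidΔ₃ * braidσ₁⁻¹ := by
  rw [braidΔ₃]
  group

theorem cuspCoset_neg_inv_of_pos {x : ℚ} (hx : 0 < x) :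
    cuspCoset (-x⁻¹) = braidΔ₃ • cuspCoset x := by
  obtain ⟨n, hn⟩ := exists_nat_gt x
  induction n generalizing x with
  | zero => simp at hn; linarith
  | succ n ih =>
    rcases lt_trichotomy x 1 with h | rfl | h
    · rw [cuspCoset_of_mem_Ioo hx h, Δ_smul_Δ_smul]
    · have hneg : cuspCoset (-1⁻¹) = braidσ₁⁻¹ • cuspCoset 0 := by
        rw [← cuspCoset_sub_one]; norm_num
      have hone : cuspCoset 1 = braidσ₁ • cuspCoset 0 := by
        rw [← cuspCoset_add_one]; norm_num
      have hσ : braidσ₁⁻¹ * braidΔ₃ = braidσ₂ * braidσ₁ := by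
        rw [braidΔ₃]; group
      rw [hneg, hone, cuspCoset_zero, smul_smul braidΔ₃ braidσ₁, Δ_mul_σ₁, mul_smul,
        Δ_smul_Δ_smul, smul_smul, hσ, MulAction.Quotient.smul_coe, MulAction.Quotient.smul_coe,
        smul_eq_mul, smul_eq_mul, mul_one, mul_one,
        QuotientGroup.mk_mul_of_mem _ σ₁_mem_cuspSubgroup]
    · have hx1 : 0 < x - 1 := sub_pos.mpr h
      have h1 : -x⁻¹ = (1 - x⁻¹) - 1 := by ring
      have hpos : 0 < 1 - x⁻¹ := sub_pos.mpr (inv_lt_one_of_one_lt₀ h)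
      have hlt : 1 - x⁻¹ < 1 := sub_lt_self _ (inv_pos.mpr hx)
      have h2 : -(1 - x⁻¹)⁻¹ = -(x - 1)⁻¹ - 1 := by
        have hd : 1 - x⁻¹ = (x - 1) / x := by field_simp
        rw [hd]
        have := hx1.ne'
        field_simp
        ring
      have hσ : braidσ₁⁻¹ * (braidΔ₃ * (braidσ₁⁻¹ * (braidΔ₃ * braidσ₁⁻¹))) = braidΔ₃ := by
        simp only [← mul_assoc]
        rw [← σ₂_eq, ← Δ_mul_σ₁, mul_inv_cancel_right]
      rw [h1, cuspCoset_sub_one, cuspCoset_of_mem_Ioo hpos hlt, h2, cuspCoset_sub_one,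
        ih hx1 (by push_cast at hn; linarith), cuspCoset_sub_one]
      simp only [smul_smul, hσ]

theorem cuspCoset_neg_inv {x : ℚ} (hx : x ≠ 0) :
    cuspCoset (-x⁻¹) = braidΔ₃ • cuspCoset x := by
  rcases hx.lt_or_gt with h | h
  · have := cuspCoset_neg_inv_of_pos (x := -x⁻¹) (by simpa using h)
    rw [inv_neg, inv_inv, neg_neg] at this
    rw [this, Δ_smul_Δ_smul]
  · exact cuspCoset_neg_inv_of_pos h

/-- The coset of `cuspSubgroup` attached to an integer vector, depending only on its slope. -/
noncomputable def vecCoset (v : Fin 2 → ℤ) : BraidGroup3 ⧸ cuspSubgroup :=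
  if v 1 = 0 then ((1 : BraidGroup3) : BraidGroup3 ⧸ cuspSubgroup)
  else cuspCoset ((v 0 : ℚ) / v 1)

open Matrix

/-- The images of `σ₁` and `σ₂` under the standard representation `B₃ → SL₂(ℤ)`. -/
def slGenerators : Fin 2 → SpecialLinearGroup (Fin 2) ℤ :=
  ![⟨!![1, 1; 0, 1], by simp⟩, ⟨!![1, 0; -1, 1], by simp⟩]

/-- The standard representation `B₃ → SL₂(ℤ)`. -/
def toSL : BraidGroup3 →* SpecialLinearGroup (Fin 2) ℤ :=
  PresentedGroup.toGroup (f := slGenerators) (by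
    rintro _ rfl
    simp only [map_mul, map_inv, FreeGroup.lift_apply_of, mul_inv_eq_iff_eq_mul, one_mul]
    exact Subtype.ext (by decide))

theorem toSL_σ₁ : (toSL braidσ₁ : Matrix (Fin 2) (Fin 2) ℤ) = !![1, 1; 0, 1] := by
  simp [toSL, slGenerators, braidσ₁]

theorem toSL_σ₂ : (toSL braidσ₂ : Matrix (Fin 2) (Fin 2) ℤ) = !![1, 0; -1, 1] := by
  simp [toSL, slGenerators, braidσ₂]

theorem toSL_Δ : (toSL braidΔ₃ : Matrix (Fin 2) (Fin 2) ℤ) = !![0, 1; -1, 0] := by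
  simp [braidΔ₃, toSL_σ₁, toSL_σ₂]

theorem toSL_σ₁_zpow (k : ℤ) :
    (toSL (braidσ₁ ^ k) : Matrix (Fin 2) (Fin 2) ℤ) = !![1, k; 0, 1] := by
  have h : toSL braidσ₁ = ModularGroup.T := by
    ext1
    rw [toSL_σ₁, ModularGroup.T]
  rw [map_zpow, h, ModularGroup.coe_T_zpow]

theorem toSL_σ₁_smul (v : Fin 2 → ℤ) : toSL braidσ₁ • v = ![v 0 + v 1, v 1] := by
  rw [Matrix.SpecialLinearGroup.smul_def, toSL_σ₁]
  ext i
  fin_cases i <;> simp [vecHead, vecTail]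

theorem toSL_Δ_smul (v : Fin 2 → ℤ) : toSL braidΔ₃ • v = ![v 1, -v 0] := by
  rw [Matrix.SpecialLinearGroup.smul_def, toSL_Δ]
  ext i
  fin_cases i <;> simp [vecHead, vecTail]

theorem vecCoset_σ₁ (v : Fin 2 → ℤ) :
    vecCoset (toSL braidσ₁ • v) = braidσ₁ • vecCoset v := by
  rw [toSL_σ₁_smul]
  by_cases h : v 1 = 0
  · simpa [vecCoset, h, eq_comm, QuotientGroup.eq] using σ₁_mem_cuspSubgroup
  · have h' : (v 1 : ℚ) ≠ 0 := by exact_mod_cast h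
    simp [vecCoset, h, ← cuspCoset_add_one, add_div, h']

theorem vecCoset_Δ {v : Fin 2 → ℤ} (hv : v ≠ 0) :
    vecCoset (toSL braidΔ₃ • v) = braidΔ₃ • vecCoset v := by
  rw [toSL_Δ_smul]
  by_cases h1 : v 1 = 0
  · have h0 : v 0 ≠ 0 := fun h0 => hv (by ext i; fin_cases i <;> simp [h0, h1])
    simp [vecCoset, h0, h1, cuspCoset_zero]
  · by_cases h0 : v 0 = 0
    · have h := Δ_smul_Δ_smul ((1 : BraidGroup3) : BraidGroup3 ⧸ cuspSubgroup)
      simpa [vecCoset, h0, h1, cuspCoset_zero] using h.symm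
    · have hne : (v 0 : ℚ) / v 1 ≠ 0 := by simp [h0, h1]
      simp [vecCoset, h0, h1, ← cuspCoset_neg_inv hne, div_neg]

/-- `vecCoset` is equivariant on nonzero vectors. -/
theorem vecCoset_smul (b : BraidGroup3) {v : Fin 2 → ℤ} (hv : v ≠ 0) :
    vecCoset (toSL b • v) = b • vecCoset v := by
  have hb : b ∈ Subgroup.closure {braidσ₁, braidσ₂} := by simp [closure_generators]
  induction hb using Subgroup.closure_induction generalizing v with
  | mem x hx =>
    have hinv (w : Fin 2 → ℤ) : vecCoset (toSL braidσ₁⁻¹ • w) = braidσ₁⁻¹ • vecCoset w := by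
      rw [eq_inv_smul_iff, ← vecCoset_σ₁, map_inv, smul_inv_smul]
    rcases hx with rfl | rfl
    · exact vecCoset_σ₁ v
    · rw [σ₂_eq, map_mul, map_mul, mul_smul, mul_smul, hinv,
        vecCoset_Δ ((smul_ne_zero_iff_ne _).mpr hv), hinv, mul_smul, mul_smul]
  | one => simp
  | mul x y _ _ hx hy =>
    rw [map_mul, mul_smul, hx ((smul_ne_zero_iff_ne _).mpr hv), hy hv, mul_smul]
  | inv x _ hx =>
    rw [eq_inv_smul_iff, ← hx ((smul_ne_zero_iff_ne _).mpr hv), map_inv, smul_inv_smul]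

/-- An element acting on the integer plane by an upper triangular matrix lies in
`cuspSubgroup`. -/
theorem mem_cuspSubgroup_of_toSL_apply_eq_zero {b : BraidGroup3} (h : toSL b 1 0 = 0) :
    b ∈ cuspSubgroup := by
  have hv : (![1, 0] : Fin 2 → ℤ) ≠ 0 := fun h => one_ne_zero (congrFun h 0)
  have := vecCoset_smul b hv
  rw [Matrix.SpecialLinearGroup.smul_def] at this
  simpa [vecCoset, mulVec, dotProduct, h, QuotientGroup.eq] using this

end BraidGroup3

open BraidGroup3 in
/-- **Lemma 8.8.** In `B₃`, for any nonzero integer `k` the centralizer of `σ₁^k` is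
`{σ₁^{k'}·Δ₃^{2ℓ'} : k', ℓ' ∈ ℤ}`: an element `b` commutes with `σ₁^k` iff
`b = σ₁^{k'}·Δ₃^{2ℓ'}` for some integers `k'`, `ℓ'`. -/
theorem lemma_8_8 (k : ℤ) (hk : k ≠ 0) (b : BraidGroup3) :
    b * braidσ₁ ^ k = braidσ₁ ^ k * b ↔
      ∃ k' l' : ℤ, b = braidσ₁ ^ k' * braidΔ₃ ^ (2 * l') := by
  rw [← mem_cuspSubgroup]
  constructor
  · intro h
    apply mem_cuspSubgroup_of_toSL_apply_eq_zero
    have h' := congrArg (fun g => (toSL g : Matrix (Fin 2) (Fin 2) ℤ) 1 1) h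
    simp only [map_mul, Matrix.SpecialLinearGroup.coe_mul, toSL_σ₁_zpow] at h'
    simpa [Matrix.mul_apply, hk] using h'
  · rintro ⟨k', l', rfl⟩
    exact (((Commute.refl braidσ₁).zpow_zpow k' k).mul_left
      ((commute_Δ_sq (braidσ₁ ^ k)).zpow_left l')).eq
end
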